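/- arXiv:1303.6341 — 3 statements merged into one kernel-verified Lean document; each statement's English description precedes it below -/
import Mathlib

section
/- Let n ≥ 1 and let p be a wheel polynomial of order n such that p(π) = 0 for every π ∈ NC_n. Then p is the zero polynomial. Consequently, a wheel polynomial of order n is determined uniquely by its π-evaluations as π ranges over NC_n. -/
open scoped BigOperators

open MvPolynomial

attribute [local instance 10] Classical.propDecidable

/-- A noncrossing matching of order `n`, on the points `0, …, 2n-1`
(representing the 1-indexed points `1, …, 2n`): a fixed-point-free involution
with no crossing `a < b < c < d`, `f a = c`, `f b = d`. -/
structure NCM (n : ℕ) where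
  f : Fin (2 * n) → Fin (2 * n)
  invol : ∀ k, f (f k) = k
  nofix : ∀ k, f k ≠ k
  noncross : ∀ a b c d : Fin (2 * n), a < b → b < c → c < d → f a = c → f b = d → False

theorem NCM.ext' {n : ℕ} {π σ : NCM n} (h : π.f = σ.f) : π = σ := by
  cases π; cases σ; simpa using h

noncomputable instance {n : ℕ} : Fintype (NCM n) :=
  Fintype.ofInjective NCM.f fun _ _ h => NCM.ext' h

/-- `q = e^{2πi/3}`. -/
noncomputable def q : ℂ := Complex.exp (2 * Real.pi * Complex.I / 3)

/-- A wheel polynomial of order `n`: homogeneous of total degree `n(n-1)` and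
vanishing under every substitution `z_j := q² z_i`, `z_k := q⁴ z_i` for `i < j < k`. -/
def IsWheel (n : ℕ) (p : MvPolynomial (Fin (2 * n)) ℂ) : Prop :=
  p.IsHomogeneous (n * (n - 1)) ∧
  ∀ i j k : Fin (2 * n), i < j → j < k →
    (aeval fun l : Fin (2 * n) =>
      if l = j then C (q ^ 2) * X i
      else if l = k then C (q ^ 4) * X i
      else (X l : MvPolynomial (Fin (2 * n)) ℂ)) p = 0

/-- The `π`-evaluation `p(π) = p(q^{-π_1}, …, q^{-π_{2n}})`, where the `k`-th coordinate
is `q⁻¹` if `π` matches `k` to the right and `q` if it matches `k` to the left. -/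
noncomputable def evalNC {n : ℕ} (p : MvPolynomial (Fin (2 * n)) ℂ) (π : NCM n) : ℂ :=
  eval (fun k => if k < π.f k then q⁻¹ else q) p

/-- Evaluation of a polynomial with all variables set to `1`. -/
noncomputable def evalOne {n : ℕ} (p : MvPolynomial (Fin (2 * n)) ℂ) : ℂ :=
  eval (fun _ => (1 : ℂ)) p

/-- The alternating sign matrix numbers `ASM(n) = ∏_{j=0}^{n-1} (3j+1)!/(n+j)!`. -/
noncomputable def ASM (n : ℕ) : ℂ :=
  ∏ j ∈ Finset.range n, ((3 * j + 1).factorial : ℂ) / ((n + j).factorial : ℂ)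

/-- Cyclic successor on `Fin m`. -/
def fsucc {m : ℕ} (k : Fin m) : Fin m := ⟨((k : ℕ) + 1) % m, Nat.mod_lt _ k.pos⟩

/-- The Temperley–Lieb operator `e_k` (underlying function on points): if `π` matches
`k` with `k+1` it is `π`; otherwise it matches `k ↔ k+1`, `π(k) ↔ π(k+1)` and agrees
with `π` elsewhere (indices cyclic modulo `2n`). -/
def eRaw {n : ℕ} (k : Fin (2 * n)) (π : NCM n) : Fin (2 * n) → Fin (2 * n) :=
  if π.f k = fsucc k then π.f
  else fun m =>
    if m = k then fsucc k
    else if m = fsucc k then k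
    else if m = π.f k then π.f (fsucc k)
    else if m = π.f (fsucc k) then π.f k
    else π.f m

/-- The stationarity linear system `2n·v_π = Σ_{k=1}^{2n} Σ_{π' : e_k(π') = π} v_{π'}`. -/
def Stationary {n : ℕ} (v : NCM n → ℂ) : Prop :=
  ∀ π : NCM n, ((2 * n : ℕ) : ℂ) * v π =
    ∑ k : Fin (2 * n), ∑ π' : NCM n, if eRaw k π' = π.f then v π' else 0


theorem q_cube : q ^ 3 = 1 := by
  unfold q
  rw [← Complex.exp_nat_mul, ← Complex.exp_two_pi_mul_I]
  congr 1
  push_cast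
  ring

theorem q_ne_zero : q ≠ 0 := by
  intro h
  have := q_cube
  rw [h] at this
  norm_num at this

theorem q_ne_one : q ≠ 1 := by
  intro h
  have h2 : IsPrimitiveRoot q 3 := by
    have := Complex.isPrimitiveRoot_exp 3 (by norm_num)
    simpa [q] using this
  exact h2.ne_one (by norm_num) h

theorem q_sq_ne_one : q ^ 2 ≠ 1 := by
  intro h
  apply q_ne_one
  have := q_cube
  calc q = q ^ 2 * q := by rw [h, one_mul]
    _ = 1 := by rw [← this]; ring

theorem q_inv : q⁻¹ = q ^ 2 := by
  have h := q_cube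
  have h0 := q_ne_zero
  field_simp
  rw [h]

theorem eval_aeval_eq {σ τ : Type} (g : σ → MvPolynomial τ ℂ) (v : τ → ℂ)
    (p : MvPolynomial σ ℂ) : eval v (aeval g p) = eval (fun l => eval v (g l)) p := by
  induction p using MvPolynomial.induction_on with
  | C a => simp
  | add p q hp hq => rw [map_add, map_add, map_add, hp, hq]
  | mul_X p i hp => rw [map_mul, map_mul, map_mul, hp, aeval_X, eval_X]

theorem totalDegree_aeval_le_of {σ τ : Type} (g : σ → MvPolynomial τ ℂ)
    (hg : ∀ l, (g l).totalDegree ≤ 1) (p : MvPolynomial σ ℂ) :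
    (aeval g p).totalDegree ≤ p.totalDegree := by
  rw [aeval_def, eval₂_eq]
  refine totalDegree_finsetSum_le fun d hd => ?_
  refine (totalDegree_mul _ _).trans ?_
  have h1 : ((algebraMap ℂ (MvPolynomial τ ℂ)) (coeff d p)).totalDegree = 0 :=
    totalDegree_C _
  rw [h1, zero_add]
  refine (totalDegree_finsetProd _ _).trans ?_
  refine le_trans ?_ (le_totalDegree hd)
  rw [Finsupp.sum]
  refine Finset.sum_le_sum fun i _ => ?_
  refine (totalDegree_pow _ _).trans ?_
  calc d i * (g i).totalDegree ≤ d i * 1 := Nat.mul_le_mul_left _ (hg i)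
    _ = d i := mul_one _

/-- `l = X j - g` where `g` does not involve `X j`. -/
structure Lin {σ : Type} (j : σ) (g : MvPolynomial σ ℂ) : Prop where
  fixed : aeval (Function.update (X : σ → MvPolynomial σ ℂ) j g) g = g
  ne : X j - g ≠ 0

theorem Lin.dvd_iff {σ : Type} {j : σ} {g : MvPolynomial σ ℂ} (h : Lin j g)
    (f : MvPolynomial σ ℂ) :
    (X j - g) ∣ f ↔ aeval (Function.update (X : σ → MvPolynomial σ ℂ) j g) f = 0 := by
  constructor
  · rintro ⟨r, rfl⟩
    rw [map_mul, map_sub, h.fixed]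
    simp
  · intro h0
    have key : (Ideal.Quotient.mkₐ ℂ (Ideal.span {X j - g})).comp
        (aeval (Function.update (X : σ → MvPolynomial σ ℂ) j g)) =
        Ideal.Quotient.mkₐ ℂ (Ideal.span {X j - g}) := by
      apply MvPolynomial.algHom_ext
      intro i
      by_cases hi : i = j
      · subst hi
        simp only [AlgHom.comp_apply, aeval_X, Function.update_self, Ideal.Quotient.mkₐ_eq_mk]
        rw [eq_comm, Ideal.Quotient.eq]
        exact Ideal.mem_span_singleton_self _
      · simp [Function.update_of_ne hi]
    have := congrArg (fun F => F f) key
    simp only [AlgHom.comp_apply, h0, map_zero, Ideal.Quotient.mkₐ_eq_mk] at this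
    rw [← Ideal.mem_span_singleton]
    exact Ideal.Quotient.eq_zero_iff_mem.mp this.symm

theorem Lin.prime {σ : Type} {j : σ} {g : MvPolynomial σ ℂ} (h : Lin j g) :
    Prime (X j - g) := by
  refine ⟨h.ne, ?_, ?_⟩
  · intro hu
    have := hu.map (aeval (Function.update (X : σ → MvPolynomial σ ℂ) j g))
    rw [(h.dvd_iff _).1 dvd_rfl] at this
    exact not_isUnit_zero this
  · intro a b hab
    rw [h.dvd_iff, map_mul, mul_eq_zero] at hab
    rwa [h.dvd_iff, h.dvd_iff]

theorem Lin.dvd_of_vanish {σ : Type} {j : σ} {g : MvPolynomial σ ℂ} (h : Lin j g)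
    {f : MvPolynomial σ ℂ} (hf : ∀ v, v j = eval v g → eval v f = 0) :
    (X j - g) ∣ f := by
  rw [h.dvd_iff]
  apply MvPolynomial.funext
  intro v
  rw [eval_aeval_eq, map_zero]
  apply hf
  conv_rhs => rw [← eval_aeval_eq, h.fixed]
  simp

theorem Lin.one_le_totalDegree {σ : Type} {j : σ} {g : MvPolynomial σ ℂ} (h : Lin j g) :
    1 ≤ (X j - g).totalDegree := by
  by_contra hlt
  have h0 : (X j - g).totalDegree = 0 := by omega
  rw [totalDegree_eq_zero_iff_eq_C] at h0
  have h1 := h.ne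
  have h2 := h.prime.not_isUnit
  rw [h0] at h1 h2
  apply h2
  apply IsUnit.map C
  rw [isUnit_iff_ne_zero]
  intro h3
  rw [h3] at h1
  simp at h1

theorem prod_dvd_degree {σ ι : Type} (s : Finset ι) (j : ι → σ) (g : ι → MvPolynomial σ ℂ)
    (hl : ∀ a ∈ s, Lin (j a) (g a))
    (hsep : ∀ a ∈ s, ∀ b ∈ s, a ≠ b → ∃ v, v (j a) = eval v (g a) ∧ v (j b) ≠ eval v (g b))
    (f : MvPolynomial σ ℂ) (hf : ∀ a ∈ s, ∀ v, v (j a) = eval v (g a) → eval v f = 0) :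
    ∃ r, f = (∏ a ∈ s, (X (j a) - g a)) * r ∧
      (f ≠ 0 → r.totalDegree + s.card ≤ f.totalDegree) := by
  induction s using Finset.induction_on with
  | empty => exact ⟨f, by simp, by simp⟩
  | insert a s has ih =>
    obtain ⟨r, hr, hd⟩ := ih (fun b hb => hl b (Finset.mem_insert_of_mem hb))
      (fun b hb c hc => hsep b (Finset.mem_insert_of_mem hb) c (Finset.mem_insert_of_mem hc))
      (fun b hb => hf b (Finset.mem_insert_of_mem hb))
    have ha := hl a (Finset.mem_insert_self _ _)
    have hdvd := ha.dvd_of_vanish (hf a (Finset.mem_insert_self _ _))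
    rw [hr] at hdvd
    have hr' : (X (j a) - g a) ∣ r := by
      rcases ha.prime.dvd_or_dvd hdvd with h | h
      · exfalso
        obtain ⟨b, hb, hb2⟩ := (Prime.dvd_finsetProd_iff ha.prime _).1 h
        obtain ⟨v, hv1, hv2⟩ := hsep a (Finset.mem_insert_self _ _) b
          (Finset.mem_insert_of_mem hb) (fun h => has (h ▸ hb))
        obtain ⟨t, ht⟩ := hb2
        have := congrArg (eval v) ht
        simp only [map_sub, map_mul, eval_X, hv1, sub_self, zero_mul] at this
        exact hv2 (sub_eq_zero.1 this)
      · exact h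
    obtain ⟨t, ht⟩ := hr'
    refine ⟨t, ?_, ?_⟩
    · rw [Finset.prod_insert has, hr, ht]; ring
    · intro hf0
      have h1 := hd hf0
      have ht0 : t ≠ 0 := by
        rintro rfl
        apply hf0
        rw [hr, ht]; simp
      rw [ht, totalDegree_mul_of_isDomain ha.ne ht0] at h1
      have := ha.one_le_totalDegree
      rw [Finset.card_insert_of_notMem has]
      omega

theorem lin_const {σ : Type} (j : σ) (a : ℂ) : Lin j (C a : MvPolynomial σ ℂ) := by
  refine ⟨by simp, fun h => ?_⟩
  have := congrArg (eval (fun _ => a + 1)) h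
  simp at this

theorem lin_two {σ : Type} (i j : σ) (hij : i ≠ j) (a : ℂ) :
    Lin j (C a * X i : MvPolynomial σ ℂ) := by
  refine ⟨by simp [Function.update_of_ne hij], fun h => ?_⟩
  have := congrArg (eval (fun l => if l = j then 1 else 0)) h
  simp [hij] at this

theorem card_lt_pairs (σ : Type) [Fintype σ] [LinearOrder σ] :
    2 * (Finset.univ.filter fun x : σ × σ => x.1 < x.2).card =
      Fintype.card σ * (Fintype.card σ - 1) := by
  have h1 : (Finset.univ.filter fun x : σ × σ => x.1 < x.2).card =
      (Finset.univ.filter fun x : σ × σ => x.2 < x.1).card := by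
    apply Finset.card_bij (fun x _ => x.swap)
    · simp
    · intro a _ b _ h; exact Prod.swap_injective h
    · intro b hb; exact ⟨b.swap, by simpa using hb, by simp⟩
  have h2 : (Finset.univ : Finset σ).offDiag =
      (Finset.univ.filter fun x : σ × σ => x.1 < x.2) ∪
      (Finset.univ.filter fun x : σ × σ => x.2 < x.1) := by
    ext x
    simp [lt_or_lt_iff_ne]
  have h3 := congrArg Finset.card h2
  rw [Finset.card_union_of_disjoint, Finset.offDiag_card, ← h1] at h3
  · rw [Finset.card_univ] at h3
    rw [two_mul, ← h3, Nat.mul_sub, mul_one]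
  · rw [Finset.disjoint_left]
    intro x hx hy
    simp at hx hy
    exact lt_asymm hx hy

/-- Vanishing on all hyperplanes `z_j = q² z_i`, `i < j`, plus low degree, gives zero. -/
theorem zero_of_vanish {σ : Type} [Fintype σ] [LinearOrder σ] (n : ℕ) (hn : 1 ≤ n)
    (hc : Fintype.card σ = 2 * n) (p : MvPolynomial σ ℂ) (hd : p.totalDegree ≤ n * (n - 1))
    (hv : ∀ i j : σ, i < j → ∀ v : σ → ℂ, v j = q ^ 2 * v i → eval v p = 0) : p = 0 := by
  by_contra hp
  obtain ⟨r, -, hr⟩ := prod_dvd_degree (Finset.univ.filter fun x : σ × σ => x.1 < x.2)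
    (fun x => x.2) (fun x => C (q ^ 2) * X x.1)
    (by
      intro a ha
      simp at ha
      exact lin_two _ _ ha.ne _)
    (by
      rintro ⟨i, j⟩ ha ⟨k, l⟩ hb hne
      simp only [Finset.mem_filter, Finset.mem_univ, true_and] at ha hb
      have hq := q_ne_zero
      simp only [map_mul, eval_C, eval_X]
      by_cases hlj : l = j
      · subst hlj
        have hki : k ≠ i := fun h => hne (by rw [h])
        refine ⟨fun m => if m = k then 1 else 0, ?_, ?_⟩
        · simp [hb.ne', hki.symm]
        · simpa [hb.ne'] using (pow_ne_zero 2 hq).symm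
      · by_cases hli : l = i
        · subst hli
          refine ⟨fun m => if m = l then 1 else if m = j then q ^ 2 else 0, ?_, ?_⟩
          · simp [ha.ne']
          · simp [hb.ne, (hb.trans ha).ne]
        · refine ⟨fun m => if m = l then 1 else 0, ?_, ?_⟩
          · simp [Ne.symm hlj, Ne.symm hli]
          · simp [hb.ne])
    p (by
      intro a ha v h
      simp at ha h
      exact hv _ _ ha v h)
  have h1 := hr hp
  have h2 := card_lt_pairs σ
  rw [hc] at h2
  obtain ⟨m, rfl⟩ : ∃ m, n = m + 1 := ⟨n - 1, by omega⟩
  have h3 : 2 * (m + 1) - 1 = 2 * m + 1 := by omega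
  rw [h3] at h2
  simp only [Nat.add_sub_cancel] at hd
  nlinarith

/-- Pointwise wheel condition over an arbitrary linear order. -/
def PWheel {σ : Type} [LinearOrder σ] (p : MvPolynomial σ ℂ) : Prop :=
  ∀ i j k : σ, i < j → j < k → ∀ v : σ → ℂ, v j = q ^ 2 * v i → v k = q * v i → eval v p = 0

/-- The variables that remain after removing `i` and `j`. -/
abbrev Rest {σ : Type} (i j : σ) : Type := {l : σ // l ≠ i ∧ l ≠ j}

/-- Extend a point on the remaining variables by `z_i = c`, `z_j = q² c`. -/
noncomputable def extPt {σ : Type} (i j : σ) (c : ℂ) (w : Rest i j → ℂ) : σ → ℂ := fun l =>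
  if h : l ≠ i ∧ l ≠ j then w ⟨l, h⟩ else if l = i then c else q ^ 2 * c

/-- Substitute `z_i = c`, `z_j = q² c`. -/
noncomputable def subPoly {σ : Type} (i j : σ) (c : ℂ) (p : MvPolynomial σ ℂ) :
    MvPolynomial (Rest i j) ℂ :=
  aeval (fun l => if h : l ≠ i ∧ l ≠ j then X ⟨l, h⟩ else C (if l = i then c else q ^ 2 * c)) p

theorem eval_subPoly {σ : Type} (i j : σ) (c : ℂ) (p : MvPolynomial σ ℂ) (w : Rest i j → ℂ) :
    eval w (subPoly i j c p) = eval (extPt i j c w) p := by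
  unfold subPoly
  rw [eval_aeval_eq]
  congr 2
  funext l
  unfold extPt
  split_ifs <;> simp

theorem extPt_rest {σ : Type} (i j : σ) (c : ℂ) (w : Rest i j → ℂ) (l : Rest i j) :
    extPt i j c w l = w l := by
  unfold extPt
  rw [dif_pos l.2]

theorem extPt_fst {σ : Type} (i j : σ) (c : ℂ) (w : Rest i j → ℂ) :
    extPt i j c w i = c := by
  unfold extPt
  simp

theorem extPt_snd {σ : Type} {i j : σ} (h : i ≠ j) (c : ℂ) (w : Rest i j → ℂ) :
    extPt i j c w j = q ^ 2 * c := by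
  unfold extPt
  simp [h.symm]

theorem totalDegree_subPoly {σ : Type} (i j : σ) (c : ℂ) (p : MvPolynomial σ ℂ) :
    (subPoly i j c p).totalDegree ≤ p.totalDegree := by
  apply totalDegree_aeval_le_of
  intro l
  split_ifs
  · rw [totalDegree_X]
  · rw [totalDegree_C]; omega
  · rw [totalDegree_C]; omega

theorem card_rest {σ : Type} [Fintype σ] [LinearOrder σ] {i j : σ} (h : i ≠ j) :
    Fintype.card (Rest i j) = Fintype.card σ - 2 := by
  rw [Fintype.card_subtype]
  have : (Finset.univ.filter fun l : σ => l ≠ i ∧ l ≠ j) = ({i, j} : Finset σ)ᶜ := by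
    ext l; simp
  rw [this, Finset.card_compl, Finset.card_pair h]

theorem PWheel.of_mul {σ ι : Type} [LinearOrder σ] (s : Finset ι) (f : ι → σ) (a : ι → ℂ)
    (r : MvPolynomial σ ℂ) (h : PWheel ((∏ x ∈ s, (X (f x) - C (a x))) * r)) : PWheel r := by
  intro i j k hij hjk v hj hk
  let g : σ → MvPolynomial σ ℂ := fun l =>
    if l = j then C (q ^ 2) * X i else if l = k then C q * X i else X l
  have hik : i < k := hij.trans hjk
  have hev : ∀ w, (fun l => eval w (g l)) =
      fun l => if l = j then q ^ 2 * w i else if l = k then q * w i else w l := by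
    intro w
    funext l
    simp only [g]
    split_ifs <;> simp
  have h0 : aeval g ((∏ x ∈ s, (X (f x) - C (a x))) * r) = 0 := by
    apply MvPolynomial.funext
    intro w
    rw [eval_aeval_eq, hev, map_zero]
    apply h i j k hij hjk
    · simp [hij.ne, hik.ne]
    · simp [hij.ne, hik.ne, hjk.ne']
  rw [map_mul, mul_eq_zero] at h0
  rcases h0 with h0 | h0
  · exfalso
    rw [map_prod, Finset.prod_eq_zero_iff] at h0
    obtain ⟨x, _, hx⟩ := h0
    have hq := q_ne_zero
    let u : ℂ := if f x = j then q ^ 2 else if f x = k then q else 1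
    have hu : u ≠ 0 := by
      simp only [u]
      split_ifs <;> simp [hq]
    have h1 := congrArg (eval fun _ => (a x + 1) / u) hx
    rw [eval_aeval_eq, hev] at h1
    have h2 : (if f x = j then q ^ 2 * ((a x + 1) / u) else if f x = k then q * ((a x + 1) / u)
        else (a x + 1) / u) = a x + 1 := by
      have h3 : u * ((a x + 1) / u) = a x + 1 := by field_simp
      refine Eq.trans ?_ h3
      generalize (a x + 1) / u = y
      simp only [u]
      split_ifs <;> simp
    simp only [map_sub, eval_X, eval_C, map_zero] at h1
    rw [h2] at h1
    simp at h1
  · have := congrArg (eval v) h0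
    rw [eval_aeval_eq, hev, map_zero] at this
    convert this using 2
    congr 1
    funext l
    split_ifs with h1 h2
    · rw [h1, hj]
    · rw [h2, hk]
    · rfl

theorem step {σ : Type} [Fintype σ] [LinearOrder σ] (p : MvPolynomial σ ℂ) (hW : PWheel p)
    (i j : σ) (hij : i < j)
    (hb : ∀ l, i < l → l < j → (∀ v : σ → ℂ, v l = q ^ 2 * v i → eval v p = 0) ∧
      (∀ v : σ → ℂ, v j = q ^ 2 * v l → eval v p = 0)) (c : ℂ) (hc : c ≠ 0) :
    ∃ P r, subPoly i j c p = P * r ∧ PWheel r ∧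
      (subPoly i j c p ≠ 0 → r.totalDegree + (Fintype.card σ - 2) ≤ p.totalDegree ∧
        ((∃ l, i < l ∧ l < j) → r.totalDegree + (Fintype.card σ - 2) < p.totalDegree)) ∧
      ((¬ ∃ l, i < l ∧ l < j) → ∀ w : Rest i j → ℂ, (∀ l, w l ≠ q * c) → eval w P ≠ 0) := by
  let B : Type := {l : Rest i j // i < l.1 ∧ l.1 < j}
  let f : Rest i j ⊕ B → Rest i j := Sum.elim id Subtype.val
  let a : Rest i j ⊕ B → ℂ :=
    Sum.elim (fun l => if i < l.1 ∧ l.1 < j then q ^ 2 * c else q * c) (fun _ => c)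
  have hq3 := q_cube
  have hne : ∀ l : Rest i j, i < l.1 ∧ l.1 < j → q ^ 2 * c ≠ c := by
    intro l _ h
    apply q_sq_ne_one
    exact mul_right_cancel₀ hc (by rw [h, one_mul])
  obtain ⟨r, hr, hd⟩ := prod_dvd_degree (Finset.univ : Finset (Rest i j ⊕ B)) f
    (fun x => C (a x)) (fun x _ => lin_const _ _)
    (by
      intro x _ y _ hxy
      simp only [eval_C]
      by_cases hf : f x = f y
      · refine ⟨fun _ => a x, rfl, ?_⟩
        rcases x with x | x <;> rcases y with y | y
        · exact absurd (congrArg Sum.inl hf) hxy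
        · have : x = y.1 := hf
          subst this
          simp only [a, Sum.elim_inl, Sum.elim_inr, if_pos y.2]
          exact hne _ y.2
        · have : x.1 = y := hf
          subst this
          simp only [a, Sum.elim_inl, Sum.elim_inr, if_pos x.2]
          exact (hne _ x.2).symm
        · exact absurd (congrArg Sum.inr (Subtype.ext hf)) hxy
      · refine ⟨fun l => if l = f x then a x else a y + 1, by simp, ?_⟩
        simp [Ne.symm hf])
    (subPoly i j c p)
    (by
      intro x _ w hw
      simp only [eval_C] at hw
      rw [eval_subPoly]
      have e1 := extPt_fst i j c w
      have e2 := extPt_snd hij.ne c w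
      rcases x with x | x
      · simp only [f, a, Sum.elim_inl, id] at hw
        have e3 := extPt_rest i j c w x
        rw [hw] at e3
        split_ifs at e3 with hx
        · exact (hb x.1 hx.1 hx.2).1 _ (by rw [e3, e1])
        · rcases lt_or_gt_of_ne x.2.1 with h1 | h1
          · refine hW x.1 i j h1 hij _ ?_ ?_
            · rw [e3, e1]; linear_combination (-c) * hq3
            · rw [e3, e2]; ring
          · have h2 : j < x.1 := by
              rcases lt_or_gt_of_ne x.2.2 with h2 | h2
              · exact absurd ⟨h1, h2⟩ hx
              · exact h2
            refine hW i j x.1 hij h2 _ ?_ ?_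
            · rw [e2, e1]
            · rw [e3, e1]
      · simp only [f, a, Sum.elim_inr] at hw
        have e3 := extPt_rest i j c w x.1
        rw [hw] at e3
        exact (hb x.1 x.2.1 x.2.2).2 _ (by rw [e3, e2]))
  refine ⟨_, r, hr, ?_, ?_, ?_⟩
  · refine PWheel.of_mul Finset.univ f a r ?_
    rw [← hr]
    intro x y z hxy hyz w h1 h2
    rw [eval_subPoly]
    refine hW x y z hxy hyz _ ?_ ?_
    · rw [extPt_rest, extPt_rest, h1]
    · rw [extPt_rest, extPt_rest, h2]
  · intro h0
    have h1 := hd h0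
    have h2 := totalDegree_subPoly i j c p
    rw [Finset.card_univ, Fintype.card_sum, card_rest hij.ne] at h1
    refine ⟨by omega, ?_⟩
    rintro ⟨l, hl⟩
    have : 0 < Fintype.card B :=
      Fintype.card_pos_iff.2 ⟨⟨⟨l, hl.1.ne', hl.2.ne⟩, hl⟩⟩
    omega
  · intro hno w hw
    rw [map_prod, Finset.prod_ne_zero_iff]
    rintro (x | x) _
    · have : ¬ (i < x.1 ∧ x.1 < j) := fun h => hno ⟨_, h⟩
      simp only [f, a, Sum.elim_inl, if_neg this, map_sub, eval_X, eval_C, id]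
      exact sub_ne_zero.2 (hw x)
    · exact absurd ⟨_, x.2⟩ hno

/-- If the polynomial vanishes on `z_j = q² z_i` with `z_i ≠ 0`, it vanishes on `z_j = q² z_i`. -/
theorem vanish_of_ne_zero {σ : Type} [LinearOrder σ] (p : MvPolynomial σ ℂ) (i j : σ)
    (hij : i < j) (h : ∀ c : ℂ, c ≠ 0 → subPoly i j c p = 0) (v : σ → ℂ)
    (hv : v j = q ^ 2 * v i) : eval v p = 0 := by
  let g : σ → MvPolynomial σ ℂ := Function.update X j (C (q ^ 2) * X i)
  have hev : ∀ w, (fun l => eval w (g l)) = Function.update w j (q ^ 2 * w i) := by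
    intro w
    funext l
    by_cases hl : l = j
    · subst hl; simp [g]
    · simp [g, Function.update_of_ne hl]
  have h0 : X i * aeval g p = 0 := by
    apply MvPolynomial.funext
    intro w
    rw [map_mul, eval_X, eval_aeval_eq, hev, map_zero]
    by_cases hw : w i = 0
    · rw [hw, zero_mul]
    · have h1 := congrArg (eval fun l : Rest i j => w l) (h (w i) hw)
      rw [eval_subPoly, map_zero] at h1
      have h2 : extPt i j (w i) (fun l : Rest i j => w l) =
          Function.update w j (q ^ 2 * w i) := by
        funext l
        unfold extPt
        by_cases hl : l = j
        · subst hl; simp [hij.ne']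
        · by_cases hl' : l = i
          · subst hl'; simp [hl]
          · simp [hl, hl']
      rw [← h2, h1, mul_zero]
  have h1 : aeval g p = 0 := by
    rcases mul_eq_zero.1 h0 with h | h
    · exact absurd h (X_ne_zero i)
    · exact h
  have h2 := congrArg (eval v) h1
  rw [eval_aeval_eq, hev, map_zero, ← hv, Function.update_eq_self] at h2
  exact h2

/-- Induction on the gap. -/
theorem vanish_all {σ : Type} [Fintype σ] [LinearOrder σ] (p : MvPolynomial σ ℂ)
    (h : ∀ i j : σ, i < j →
      (∀ l, i < l → l < j → (∀ v : σ → ℂ, v l = q ^ 2 * v i → eval v p = 0) ∧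
        (∀ v : σ → ℂ, v j = q ^ 2 * v l → eval v p = 0)) →
      ∀ v : σ → ℂ, v j = q ^ 2 * v i → eval v p = 0) :
    ∀ i j : σ, i < j → ∀ v : σ → ℂ, v j = q ^ 2 * v i → eval v p = 0 := by
  have key : ∀ N : ℕ, ∀ i j : σ, (Finset.univ.filter fun l : σ => i < l ∧ l < j).card = N →
      i < j → ∀ v : σ → ℂ, v j = q ^ 2 * v i → eval v p = 0 := by
    intro N
    induction N using Nat.strong_induction_on with
    | _ N ih =>
      intro i j hN hij
      apply h i j hij
      intro l hil hlj
      constructor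
      · refine ih _ ?_ i l rfl hil
        rw [← hN]
        apply Finset.card_lt_card
        refine Finset.ssubset_iff.2 ⟨l, by simp, ?_⟩
        intro m hm
        simp only [Finset.mem_insert, Finset.mem_filter, Finset.mem_univ, true_and] at hm ⊢
        rcases hm with rfl | hm
        · exact ⟨hil, hlj⟩
        · exact ⟨hm.1, hm.2.trans hlj⟩
      · refine ih _ ?_ l j rfl hlj
        rw [← hN]
        apply Finset.card_lt_card
        refine Finset.ssubset_iff.2 ⟨l, by simp, ?_⟩
        intro m hm
        simp only [Finset.mem_insert, Finset.mem_filter, Finset.mem_univ, true_and] at hm ⊢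
        rcases hm with rfl | hm
        · exact ⟨hil, hlj⟩
        · exact ⟨hil.trans hm.1, hm.2⟩
  intro i j
  exact key _ i j rfl

theorem arith_aux (n : ℕ) : (n + 1) * (n + 1 - 1) = n * (n - 1) + (2 * (n + 1) - 2) := by
  cases n with
  | zero => rfl
  | succ m =>
    have : 2 * (m + 1 + 1) - 2 = 2 * m + 2 := by omega
    rw [this]
    simp only [Nat.add_sub_cancel]
    ring

theorem claimA (n : ℕ) : ∀ (σ : Type) [Fintype σ] [LinearOrder σ], Fintype.card σ = 2 * n →
    ∀ p : MvPolynomial σ ℂ, PWheel p → p.totalDegree < n * (n - 1) → p = 0 := by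
  induction n with
  | zero => intro σ _ _ _ p _ h; simp at h
  | succ n ih =>
    intro σ _ _ hcard p hW hd
    refine zero_of_vanish (n + 1) (by omega) hcard p hd.le (vanish_all p ?_)
    intro i j hij hb
    refine vanish_of_ne_zero p i j hij ?_
    intro c hc
    by_contra h0
    obtain ⟨P, r, hr, hrW, hrd, -⟩ := step p hW i j hij hb c hc
    have h1 := (hrd h0).1
    have h2 := arith_aux n
    rw [hcard] at h1
    have := ih (Rest i j) (by rw [card_rest hij.ne, hcard]; omega) r hrW (by omega)
    rw [hr, this, mul_zero] at h0
    exact h0 rfl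

theorem eval_smul_hom {σ : Type} {m : ℕ} {p : MvPolynomial σ ℂ} (h : p.IsHomogeneous m)
    (t : ℂ) (v : σ → ℂ) : eval (fun l => t * v l) p = t ^ m * eval v p := by
  rw [eval_eq, eval_eq, Finset.mul_sum]
  refine Finset.sum_congr rfl fun d hd => ?_
  have h1 : d.degree = m := by
    rw [Finsupp.degree_eq_weight_one]
    exact h (mem_support_iff.1 hd)
  simp only [mul_pow, Finset.prod_mul_distrib, Finset.prod_pow_eq_pow_sum]
  have h2 : ∑ x ∈ d.support, d x = m := h1
  rw [h2]
  ring

theorem PWheel.component {σ : Type} [LinearOrder σ] {p : MvPolynomial σ ℂ} (h : PWheel p)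
    (m : ℕ) : PWheel (homogeneousComponent m p) := by
  intro i j k hij hjk v hj hk
  let Q : Polynomial ℂ := ∑ m ∈ Finset.range (p.totalDegree + 1),
    Polynomial.monomial m (eval v (homogeneousComponent m p))
  have hQ : Q = 0 := by
    apply Polynomial.funext
    intro t
    have h1 := h i j k hij hjk (fun l => t * v l) (by simp only [hj]; ring)
      (by simp only [hk]; ring)
    rw [← sum_homogeneousComponent p, map_sum] at h1
    simp only [Q, Polynomial.eval_finsetSum, Polynomial.eval_monomial, Polynomial.eval_zero]
    rw [← h1]
    refine Finset.sum_congr rfl fun m _ => ?_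
    rw [eval_smul_hom (homogeneousComponent_isHomogeneous m p), mul_comm]
  by_cases hm : m < p.totalDegree + 1
  · have h2 := congrArg (fun R => Polynomial.coeff R m) hQ
    simp only [Q, Polynomial.finsetSum_coeff, Polynomial.coeff_monomial,
      Polynomial.coeff_zero] at h2
    rw [Finset.sum_ite_eq' (Finset.range (p.totalDegree + 1)) m] at h2
    simpa [hm] using h2
  · rw [homogeneousComponent_eq_zero _ _ (by omega), map_zero]

theorem wheel_homogeneous {σ : Type} [Fintype σ] [LinearOrder σ] (n : ℕ)
    (hcard : Fintype.card σ = 2 * n) (p : MvPolynomial σ ℂ) (hW : PWheel p)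
    (hd : p.totalDegree ≤ n * (n - 1)) : p.IsHomogeneous (n * (n - 1)) := by
  rw [← sum_homogeneousComponent p]
  apply IsHomogeneous.sum
  intro m hm
  simp only [Finset.mem_range] at hm
  by_cases h : m = n * (n - 1)
  · subst h; exact homogeneousComponent_isHomogeneous _ _
  · have hh := homogeneousComponent_isHomogeneous m p
    have : homogeneousComponent m p = 0 := by
      apply claimA n σ hcard _ (hW.component m)
      have := hh.totalDegree_le
      omega
    rw [this]
    exact isHomogeneous_zero _ _ _

/-- Noncrossing matchings on an arbitrary linear order. -/
structure IsM {σ : Type} [LinearOrder σ] (f : σ → σ) : Prop where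
  invol : ∀ k, f (f k) = k
  nofix : ∀ k, f k ≠ k
  noncross : ∀ a b c d : σ, a < b → b < c → c < d → f a = c → f b = d → False

/-- Extend a matching by the arc `i ↔ j`. -/
noncomputable def extM {σ : Type} (i j : σ) (g : Rest i j → Rest i j) : σ → σ := fun l =>
  if h : l ≠ i ∧ l ≠ j then (g ⟨l, h⟩).1 else if l = i then j else i

theorem extM_rest {σ : Type} (i j : σ) (g : Rest i j → Rest i j) (l : Rest i j) :
    extM i j g l = (g l).1 := by
  unfold extM
  rw [dif_pos l.2]

theorem extM_fst {σ : Type} (i j : σ) (g : Rest i j → Rest i j) : extM i j g i = j := by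
  simp [extM]

theorem extM_snd {σ : Type} {i j : σ} (h : i ≠ j) (g : Rest i j → Rest i j) :
    extM i j g j = i := by
  simp [extM, h.symm]

theorem extM_isM {σ : Type} [LinearOrder σ] {i j : σ} (hij : i < j)
    (hno : ¬ ∃ l, i < l ∧ l < j) (g : Rest i j → Rest i j) (hg : IsM g) :
    IsM (extM i j g) := by
  have e1 := extM_fst i j g
  have e2 := extM_snd hij.ne g
  have tri : ∀ k : σ, k = i ∨ k = j ∨ ∃ x : Rest i j, k = x.1 := by
    intro k
    by_cases h1 : k = i
    · exact Or.inl h1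
    · by_cases h2 : k = j
      · exact Or.inr (Or.inl h2)
      · exact Or.inr (Or.inr ⟨⟨k, h1, h2⟩, rfl⟩)
  refine ⟨?_, ?_, ?_⟩
  · intro k
    rcases tri k with rfl | rfl | ⟨x, rfl⟩
    · rw [e1, e2]
    · rw [e2, e1]
    · rw [extM_rest, extM_rest, hg.invol]
  · intro k
    rcases tri k with rfl | rfl | ⟨x, rfl⟩
    · rw [e1]; exact hij.ne'
    · rw [e2]; exact hij.ne
    · rw [extM_rest]
      exact fun h => hg.nofix x (Subtype.ext h)
  · intro a b c d hab hbc hcd ha hb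
    rcases tri a with rfl | rfl | ⟨x, rfl⟩
    · rw [e1] at ha
      exact hno ⟨b, hab, ha ▸ hbc⟩
    · rw [e2] at ha
      subst ha
      exact lt_asymm hij (hab.trans hbc)
    · rcases tri b with rfl | rfl | ⟨y, rfl⟩
      · rw [e1] at hb
        exact hno ⟨c, hbc, hb ▸ hcd⟩
      · rw [e2] at hb
        subst hb
        exact lt_asymm hij (hbc.trans hcd)
      · rw [extM_rest] at ha hb
        subst ha hb
        exact hg.noncross x y (g x) (g y) hab hbc hcd rfl rfl

theorem claimB (n : ℕ) : ∀ (σ : Type) [Fintype σ] [LinearOrder σ], Fintype.card σ = 2 * n →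
    ∀ p : MvPolynomial σ ℂ, PWheel p → p.totalDegree ≤ n * (n - 1) →
    ∀ t : ℂ, t ≠ 0 →
    (∀ f : σ → σ, IsM f → eval (fun k => t * (if k < f k then q⁻¹ else q)) p = 0) → p = 0 := by
  induction n with
  | zero =>
    intro σ _ _ hcard p _ hd t _ h
    have : IsEmpty σ := Fintype.card_eq_zero_iff.1 (by simpa using hcard)
    have h1 := h id ⟨fun k => isEmptyElim k, fun k => isEmptyElim k, fun k => isEmptyElim k⟩
    have h2 : p.totalDegree = 0 := by simpa using hd
    rw [totalDegree_eq_zero_iff_eq_C] at h2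
    rw [h2, eval_C] at h1
    rw [h2, h1, map_zero]
  | succ n ih =>
    intro σ _ _ hcard p hW hd t ht hev
    have hhom := wheel_homogeneous (n + 1) hcard p hW hd
    have hq := q_ne_zero
    have hq3 := q_cube
    have hev' : ∀ u : ℂ, ∀ f : σ → σ, IsM f →
        eval (fun k => u * (if k < f k then q⁻¹ else q)) p = 0 := by
      intro u f hf
      have h1 := hev f hf
      rw [eval_smul_hom hhom, mul_eq_zero] at h1
      rw [eval_smul_hom hhom, h1.resolve_left (pow_ne_zero _ ht), mul_zero]
    refine zero_of_vanish (n + 1) (by omega) hcard p hd (vanish_all p ?_)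
    intro i j hij hb
    refine vanish_of_ne_zero p i j hij ?_
    intro c hc
    by_contra h0
    obtain ⟨P, r, hr, hrW, hrd, hP⟩ := step p hW i j hij hb c hc
    have h1 := hrd h0
    have h2 := arith_aux n
    have hcard' : Fintype.card (Rest i j) = 2 * n := by
      rw [card_rest hij.ne, hcard]; omega
    rw [hcard] at h1
    suffices hr0 : r = 0 by
      rw [hr, hr0, mul_zero] at h0
      exact h0 rfl
    by_cases hbt : ∃ l, i < l ∧ l < j
    · have h3 := h1.2 hbt
      exact claimA n (Rest i j) hcard' r hrW (by omega)
    · refine ih (Rest i j) hcard' r hrW (by omega) (q * c) (mul_ne_zero hq hc) ?_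
      intro g hg
      set w : Rest i j → ℂ := fun k => q * c * (if k < g k then q⁻¹ else q) with hw
      have h3 := hP hbt w (by
        intro l h
        have h4 : (if l < g l then q⁻¹ else q) = 1 :=
          mul_left_cancel₀ (mul_ne_zero hq hc) (by rw [mul_one]; exact h)
        split_ifs at h4
        · exact q_ne_one (by simpa using h4)
        · exact q_ne_one h4)
      have h4 := hev' (q * c) (extM i j g) (extM_isM hij hbt g hg)
      have h5 : (fun k => q * c * (if k < extM i j g k then q⁻¹ else q)) = extPt i j c w := by
        funext k
        by_cases h1 : k = i
        · subst h1
          rw [extM_fst, extPt_fst, if_pos hij]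
          field_simp
        · by_cases h2 : k = j
          · subst h2
            rw [extM_snd hij.ne, extPt_snd hij.ne, if_neg hij.not_gt]
            ring
          · have e1 := extM_rest i j g ⟨k, h1, h2⟩
            have e2 := extPt_rest i j c w ⟨k, h1, h2⟩
            simp only at e1 e2
            rw [e1, e2, hw]
            simp only [← Subtype.coe_lt_coe]
      rw [h5, ← eval_subPoly, hr, map_mul, mul_eq_zero] at h4
      exact h4.resolve_left h3

theorem IsWheel.pwheel {n : ℕ} {p : MvPolynomial (Fin (2 * n)) ℂ} (hp : IsWheel n p) :
    PWheel p := by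
  intro i j k hij hjk v hj hk
  have h := congrArg (eval v) (hp.2 i j k hij hjk)
  rw [eval_aeval_eq, map_zero] at h
  rw [← h]
  congr 2
  funext l
  have hq4 : q ^ 4 = q := by linear_combination q * q_cube
  split_ifs with h1 h2
  · rw [h1, hj]; simp
  · rw [h2, hk, hq4]; simp
  · simp

theorem wheel_zero (n : ℕ) (p : MvPolynomial (Fin (2 * n)) ℂ) (hp : IsWheel n p)
    (h0 : ∀ π : NCM n, evalNC p π = 0) : p = 0 := by
  refine claimB n (Fin (2 * n)) (by simp) p hp.pwheel hp.1.totalDegree_le 1 one_ne_zero ?_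
  intro f hf
  have h := h0 ⟨f, hf.invol, hf.nofix, hf.noncross⟩
  unfold evalNC at h
  simp only [one_mul]
  exact h

theorem IsWheel.sub {n : ℕ} {p₁ p₂ : MvPolynomial (Fin (2 * n)) ℂ} (h1 : IsWheel n p₁)
    (h2 : IsWheel n p₂) : IsWheel n (p₁ - p₂) := by
  refine ⟨h1.1.sub h2.1, fun i j k hij hjk => ?_⟩
  rw [map_sub, h1.2 i j k hij hjk, h2.2 i j k hij hjk, sub_zero]

/-- Theorem 2.5: a wheel polynomial all of whose `π`-evaluations vanish is zero;
consequently a wheel polynomial is determined by its `π`-evaluations. -/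
theorem wheel_determined_by_evaluations (n : ℕ) (hn : 1 ≤ n)
    (p : MvPolynomial (Fin (2 * n)) ℂ) (hp : IsWheel n p)
    (h0 : ∀ π : NCM n, evalNC p π = 0) :
    p = 0 ∧
    ∀ p₁ p₂ : MvPolynomial (Fin (2 * n)) ℂ, IsWheel n p₁ → IsWheel n p₂ →
      (∀ π : NCM n, evalNC p₁ π = evalNC p₂ π) → p₁ = p₂ := by
  refine ⟨wheel_zero n p hp h0, fun p₁ p₂ h1 h2 h => ?_⟩
  refine sub_eq_zero.1 (wheel_zero n _ (h1.sub h2) fun π => ?_)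
  have := h π
  unfold evalNC at this ⊢
  rw [map_sub, this, sub_self]
end

section
/- For every n ≥ 1 the integer matrix (C_{π,σ})_{π,σ∈NC_n} satisfies: C_{π,π} = 1 for every π ∈ NC_n, and whenever C_{π,σ} ≠ 0 one has σ⁺_j ≤ π⁺_j for every 1 ≤ j ≤ n (triangularity with respect to the Young-diagram partial order on noncrossing matchings). Consequently the matrix (C_{π,σ}) is invertible and its inverse has integer entries. -/
open scoped BigOperators

open MvPolynomial

attribute [local instance 10] Classical.propDecidable

/-- A fixed-point-free involution on `2n` points has exactly `n` "openers". -/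
theorem card_openers {n : ℕ} (π : NCM n) :
    (Finset.univ.filter fun k => k < π.f k).card = n := by
  classical
  have hcard : (Finset.univ.filter fun k : Fin (2 * n) => k < π.f k).card
      = (Finset.univ.filter fun k : Fin (2 * n) => π.f k < k).card := by
    apply Finset.card_bij (fun a _ => π.f a)
    · intro a ha
      simp only [Finset.mem_filter, Finset.mem_univ, true_and] at ha ⊢
      rw [π.invol]; exact ha
    · intro a ha b hb hab
      have h := congrArg π.f hab
      rwa [π.invol, π.invol] at h
    · intro b hb
      simp only [Finset.mem_filter, Finset.mem_univ, true_and] at hb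
      refine ⟨π.f b, ?_, π.invol b⟩
      simp only [Finset.mem_filter, Finset.mem_univ, true_and]
      rw [π.invol]; exact hb
  have hdisj : Disjoint (Finset.univ.filter fun k : Fin (2 * n) => k < π.f k)
      (Finset.univ.filter fun k : Fin (2 * n) => π.f k < k) := by
    rw [Finset.disjoint_left]
    intro a haA haB
    simp only [Finset.mem_filter, Finset.mem_univ, true_and] at haA haB
    exact absurd (haA.trans haB) (lt_irrefl a)
  have hunion : (Finset.univ.filter fun k : Fin (2 * n) => k < π.f k)
      ∪ (Finset.univ.filter fun k : Fin (2 * n) => π.f k < k) = Finset.univ := by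
    ext a
    simp only [Finset.mem_union, Finset.mem_filter, Finset.mem_univ, true_and, iff_true]
    rcases lt_trichotomy a (π.f a) with h | h | h
    · exact Or.inl h
    · exact absurd h.symm (π.nofix a)
    · exact Or.inr h
  have hc := Finset.card_union_of_disjoint hdisj
  rw [hunion, Finset.card_univ, Fintype.card_fin] at hc
  omega

/-- `π⁺ : Fin n → ℕ`, the increasing enumeration (with 1-indexed values) of the
set of points matched to the right by `π`. -/
noncomputable def plus {n : ℕ} (π : NCM n) : Fin n → ℕ := fun i =>
  ((((Finset.univ.filter fun k => k < π.f k).orderIsoOfFin (card_openers π) i :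
      { x // x ∈ Finset.univ.filter fun k => k < π.f k }) : Fin (2 * n)) : ℕ) + 1

/-- `χ(m) = 0, 1, -1` according as `m ≡ 0, 1, 2 (mod 3)`. -/
def chi (m : ℤ) : ℤ := if m % 3 = 0 then 0 else if m % 3 = 1 then 1 else -1

/-- `p_{j,k}(a) = #{m : j ≤ a_m < k} − (k−j−1)/2` (arguments `j`, `k` 1-indexed). -/
def pjkSeq {N : ℕ} (a : Fin N → ℕ) (j k : ℕ) : ℤ :=
  ((Finset.univ.filter fun m : Fin N => j ≤ a m ∧ a m < k).card : ℤ)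
    - (((k - j - 1) / 2 : ℕ) : ℤ)

/-- `C_{a,σ} = ∏_{j<k matched by σ} χ(p_{j,k}(a))`. -/
noncomputable def CmatSeq {N n : ℕ} (a : Fin N → ℕ) (σ : NCM n) : ℤ :=
  ∏ j : Fin (2 * n), ∏ k : Fin (2 * n),
    if j < k ∧ σ.f j = k then chi (pjkSeq a ((j : ℕ) + 1) ((k : ℕ) + 1)) else 1

namespace CmatAux

/-- number of openers in `[j,k)` (0-indexed) -/
noncomputable def op {n : ℕ} (σ : NCM n) (j k : ℕ) : ℕ :=
  (Finset.univ.filter fun x : Fin (2 * n) => x < σ.f x ∧ j ≤ (x : ℕ) ∧ (x : ℕ) < k).card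

/-- number of closers in `[j,k)` (0-indexed) -/
noncomputable def cl {n : ℕ} (σ : NCM n) (j k : ℕ) : ℕ :=
  (Finset.univ.filter fun x : Fin (2 * n) => σ.f x < x ∧ j ≤ (x : ℕ) ∧ (x : ℕ) < k).card

theorem op_split {n : ℕ} (σ : NCM n) {a b c : ℕ} (h1 : a ≤ b) (h2 : b ≤ c) :
    op σ a c = op σ a b + op σ b c := by
  unfold op
  rw [← Finset.card_union_of_disjoint]
  · congr 1
    ext x
    simp only [Finset.mem_filter, Finset.mem_univ, true_and, Finset.mem_union]
    constructor
    · rintro ⟨h, h3, h4⟩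
      rcases lt_or_ge (x : ℕ) b with h5 | h5
      · exact Or.inl ⟨h, h3, h5⟩
      · exact Or.inr ⟨h, h5, h4⟩
    · rintro (⟨h, h3, h4⟩ | ⟨h, h3, h4⟩)
      · exact ⟨h, h3, by omega⟩
      · exact ⟨h, by omega, h4⟩
  · rw [Finset.disjoint_left]
    intro x hx hy
    simp only [Finset.mem_filter, Finset.mem_univ, true_and] at hx hy
    omega

theorem op_one_of {n : ℕ} (σ : NCM n) (x : Fin (2 * n)) (h : x < σ.f x) :
    op σ x (x + 1) = 1 := by
  unfold op
  rw [Finset.card_eq_one]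
  refine ⟨x, ?_⟩
  ext y
  simp only [Finset.mem_filter, Finset.mem_univ, true_and, Finset.mem_singleton]
  constructor
  · rintro ⟨_, h1, h2⟩
    exact Fin.ext (by omega)
  · rintro rfl
    exact ⟨h, by omega, by omega⟩

theorem op_zero_of {n : ℕ} (σ : NCM n) (x : Fin (2 * n)) (h : ¬ x < σ.f x) :
    op σ x (x + 1) = 0 := by
  unfold op
  rw [Finset.card_eq_zero]
  ext y
  simp only [Finset.mem_filter, Finset.mem_univ, true_and, Finset.notMem_empty, iff_false]
  rintro ⟨h0, h1, h2⟩
  have : y = x := Fin.ext (by omega)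
  subst this
  exact h h0

theorem op_add_cl {n : ℕ} (σ : NCM n) {j k : ℕ} (hk : k ≤ 2 * n) :
    op σ j k + cl σ j k = k - j := by
  unfold op cl
  rw [← Finset.card_union_of_disjoint]
  · rw [← Nat.card_Ico]
    apply Finset.card_bij (fun (x : Fin (2 * n)) _ => (x : ℕ))
    · intro x hx
      simp only [Finset.mem_filter, Finset.mem_univ, true_and, Finset.mem_union] at hx
      rw [Finset.mem_Ico]
      omega
    · intro x _ y _ h
      exact Fin.ext h
    · intro b hb
      rw [Finset.mem_Ico] at hb
      refine ⟨⟨b, by omega⟩, ?_, rfl⟩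
      simp only [Finset.mem_filter, Finset.mem_univ, true_and, Finset.mem_union]
      rcases lt_trichotomy (⟨b, by omega⟩ : Fin (2 * n)) (σ.f ⟨b, by omega⟩) with h | h | h
      · exact Or.inl ⟨h, hb⟩
      · exact absurd h.symm (σ.nofix _)
      · exact Or.inr ⟨h, hb⟩
  · rw [Finset.disjoint_left]
    intro x hx hy
    simp only [Finset.mem_filter, Finset.mem_univ, true_and] at hx hy
    exact absurd (hx.1.trans hy.1) (lt_irrefl _)

theorem f_inj {n : ℕ} (σ : NCM n) {x y : Fin (2 * n)} (h : σ.f x = σ.f y) : x = y := by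
  rw [← σ.invol x, h, σ.invol]

theorem op_le_cl {n : ℕ} (σ : NCM n) (j k : ℕ)
    (h : ∀ x : Fin (2 * n), x < σ.f x → j ≤ (x : ℕ) → (x : ℕ) < k → (σ.f x : ℕ) < k) :
    op σ j k ≤ cl σ j k := by
  unfold op cl
  apply Finset.card_le_card_of_injOn σ.f
  · intro x hx
    simp only [Finset.coe_filter, Finset.mem_univ, true_and, Set.mem_ofPred_eq] at hx ⊢
    have := h x hx.1 hx.2.1 hx.2.2
    rw [σ.invol]
    have h1 := hx.1
    rw [Fin.lt_def] at h1
    exact ⟨hx.1, by omega, this⟩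
  · intro x _ y _ hxy
    exact f_inj σ hxy

theorem cl_le_op {n : ℕ} (σ : NCM n) (j k : ℕ)
    (h : ∀ x : Fin (2 * n), σ.f x < x → j ≤ (x : ℕ) → (x : ℕ) < k → j ≤ (σ.f x : ℕ)) :
    cl σ j k ≤ op σ j k := by
  unfold op cl
  apply Finset.card_le_card_of_injOn σ.f
  · intro x hx
    simp only [Finset.coe_filter, Finset.mem_univ, true_and, Set.mem_ofPred_eq] at hx ⊢
    have := h x hx.1 hx.2.1 hx.2.2
    rw [σ.invol]
    have h1 := hx.1
    rw [Fin.lt_def] at h1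
    exact ⟨hx.1, this, by omega⟩
  · intro x _ y _ hxy
    exact f_inj σ hxy

/-- points inside an arc are matched inside the arc -/
theorem inside {n : ℕ} (σ : NCM n) {m x : Fin (2 * n)} (h1 : m < x) (h2 : x < σ.f m) :
    m < σ.f x ∧ σ.f x < σ.f m := by
  constructor
  · by_contra hc
    rcases lt_or_eq_of_le (not_lt.mp hc) with h | h
    · exact σ.noncross (σ.f x) m x (σ.f m) h h1 h2 (σ.invol x) rfl
    · rw [← h, σ.invol] at h2
      exact lt_irrefl _ h2
  · by_contra hc
    rcases lt_or_eq_of_le (not_lt.mp hc) with h | h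
    · exact σ.noncross m x (σ.f m) (σ.f x) h1 h2 h rfl rfl
    · exact absurd (f_inj σ h) (ne_of_lt h1)

theorem arc_count {n : ℕ} (σ : NCM n) (m : Fin (2 * n)) (h : m < σ.f m) :
    2 * op σ (m + 1) (σ.f m) + (m + 1) = (σ.f m : ℕ) := by
  have h1 := op_add_cl σ (j := m + 1) (k := σ.f m) (σ.f m).isLt.le
  have h2 : op σ (m + 1) (σ.f m) ≤ cl σ (m + 1) (σ.f m) :=
    op_le_cl σ _ _ fun x _ h3 h4 => (inside σ (m := m) (x := x) h3 h4).2
  have h3 : cl σ (m + 1) (σ.f m) ≤ op σ (m + 1) (σ.f m) :=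
    cl_le_op σ _ _ fun x _ h3 h4 => (inside σ (m := m) (x := x) h3 h4).1
  have h4 : (m : ℕ) < σ.f m := h
  omega

theorem plus_mem {n : ℕ} (π : NCM n) (i : Fin n) :
    ∃ x : Fin (2 * n), x < π.f x ∧ plus π i = x + 1 := by
  unfold plus
  refine ⟨_, ?_, rfl⟩
  have := ((Finset.univ.filter fun k => k < π.f k).orderIsoOfFin (card_openers π) i).2
  exact (Finset.mem_filter.mp this).2

theorem plus_surj {n : ℕ} (π : NCM n) (x : Fin (2 * n)) (h : x < π.f x) :
    ∃ i : Fin n, plus π i = x + 1 := by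
  unfold plus
  refine ⟨((Finset.univ.filter fun k => k < π.f k).orderIsoOfFin (card_openers π)).symm
    ⟨x, by simpa using h⟩, ?_⟩
  simp

theorem plus_strictMono {n : ℕ} (π : NCM n) : StrictMono (plus π) := by
  intro i j hij
  unfold plus
  have := ((Finset.univ.filter fun k => k < π.f k).orderIsoOfFin (card_openers π)).strictMono hij
  have h2 : ((((Finset.univ.filter fun k => k < π.f k).orderIsoOfFin (card_openers π) i :
      { x // x ∈ Finset.univ.filter fun k => k < π.f k }) : Fin (2 * n)) : ℕ) <
      ((((Finset.univ.filter fun k => k < π.f k).orderIsoOfFin (card_openers π) j :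
      { x // x ∈ Finset.univ.filter fun k => k < π.f k }) : Fin (2 * n)) : ℕ) := this
  omega

theorem plus_count {n : ℕ} (π : NCM n) (j k : ℕ) :
    (Finset.univ.filter fun m : Fin n => j + 1 ≤ plus π m ∧ plus π m < k + 1).card = op π j k := by
  unfold op
  have hx := plus_mem π
  choose g hg using hx
  apply Finset.card_bij (fun i _ => g i)
  · intro i hi
    simp only [Finset.mem_filter, Finset.mem_univ, true_and] at hi ⊢
    have := hg i
    exact ⟨this.1, by omega, by omega⟩
  · intro i _ i' _ h
    apply (plus_strictMono π).injective
    rw [(hg i).2, (hg i').2, h]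
  · intro x hx
    simp only [Finset.mem_filter, Finset.mem_univ, true_and] at hx
    obtain ⟨i, hi⟩ := plus_surj π x hx.1
    refine ⟨i, ?_, ?_⟩
    · simp only [Finset.mem_filter, Finset.mem_univ, true_and]
      omega
    · apply Fin.ext
      have := (hg i).2
      omega

theorem pjk_eq {n : ℕ} (π : NCM n) (j k : ℕ) :
    pjkSeq (plus π) (j + 1) (k + 1) = (op π j k : ℤ) - (((k - j - 1) / 2 : ℕ) : ℤ) := by
  unfold pjkSeq
  rw [← plus_count]
  congr 3
  omega

theorem diag {n : ℕ} (π : NCM n) : CmatSeq (plus π) π = 1 := by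
  unfold CmatSeq
  apply Finset.prod_eq_one
  intro j _
  apply Finset.prod_eq_one
  intro k _
  split_ifs with h
  · obtain ⟨h1, rfl⟩ := h
    rw [pjk_eq]
    have h2 := arc_count π j h1
    have h3 := op_split π (a := j) (b := j + 1) (c := π.f j) (by omega) h1
    rw [op_one_of π j h1] at h3
    have : (op π j (π.f j) : ℤ) - ((((π.f j : ℕ) - j - 1) / 2 : ℕ) : ℤ) = 1 := by omega
    rw [this]
    rfl
  · rfl

theorem nonzero_arc {n : ℕ} {π σ : NCM n} (h : CmatSeq (plus π) σ ≠ 0) (m : Fin (2 * n))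
    (hm : m < σ.f m) : op π m (σ.f m) ≠ op σ (m + 1) (σ.f m) := by
  intro he
  apply h
  unfold CmatSeq
  apply Finset.prod_eq_zero (Finset.mem_univ m)
  apply Finset.prod_eq_zero (Finset.mem_univ (σ.f m))
  rw [if_pos ⟨hm, rfl⟩, pjk_eq, he]
  have h2 := arc_count σ m hm
  have : (op σ (m + 1) (σ.f m) : ℤ) - ((((σ.f m : ℕ) - m - 1) / 2 : ℕ) : ℤ) = 0 := by omega
  rw [this]
  rfl

theorem key {n : ℕ} {π σ : NCM n} (h : CmatSeq (plus π) σ ≠ 0) :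
    ∀ d m e : ℕ, e = m + d → e ≤ 2 * n →
      (∀ x : Fin (2 * n), x < σ.f x → m ≤ (x : ℕ) → (x : ℕ) < e → (σ.f x : ℕ) < e) →
      op σ m e ≤ op π m e := by
  intro d
  induction d using Nat.strong_induction_on with
  | _ d ih =>
    intro m e he hn hcl
    rcases Nat.eq_zero_or_pos d with h0 | hpos
    · have := op_add_cl σ (j := m) (k := e) hn
      omega
    obtain ⟨x, hx⟩ : ∃ x : Fin (2 * n), (x : ℕ) = m := ⟨⟨m, by omega⟩, rfl⟩
    subst hx
    by_cases ho : x < σ.f x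
    · have hk := hcl x ho le_rfl (by omega)
      have ho' : (x : ℕ) < σ.f x := ho
      have i1 := ih ((σ.f x : ℕ) - (x + 1)) (by omega) (x + 1) (σ.f x) (by omega) (by omega)
        (fun y _ h3 h4 => (inside σ (m := x) (x := y) h3 h4).2)
      have i2 := ih (e - ((σ.f x : ℕ) + 1)) (by omega) ((σ.f x : ℕ) + 1) e (by omega) hn
        (fun y h2 h3 h4 => hcl y h2 (by omega) h4)
      have hne := nonzero_arc h x ho
      have z : op σ (σ.f x) ((σ.f x : ℕ) + 1) = 0 := op_zero_of σ _ (by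
        rw [σ.invol]; exact not_lt.mpr ho.le)
      have o := op_one_of σ x ho
      have s1 := op_split σ (a := x) (b := x + 1) (c := e) (by omega) (by omega)
      have s2 := op_split σ (a := x + 1) (b := σ.f x) (c := e) (by omega) (by omega)
      have s3 := op_split σ (a := σ.f x) (b := σ.f x + 1) (c := e) (by omega) (by omega)
      have t1 := op_split π (a := x) (b := σ.f x) (c := e) (by omega) (by omega)
      have t2 := op_split π (a := x) (b := x + 1) (c := σ.f x) (by omega) (by omega)
      have t3 := op_split π (a := σ.f x) (b := σ.f x + 1) (c := e) (by omega) (by omega)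
      omega
    · have i1 := ih (d - 1) (by omega) (x + 1) e (by omega) hn
        (fun y h2 h3 h4 => hcl y h2 (by omega) h4)
      have s1 := op_split σ (a := x) (b := x + 1) (c := e) (by omega) (by omega)
      have s2 := op_split π (a := x) (b := x + 1) (c := e) (by omega) (by omega)
      rw [op_zero_of σ x ho] at s1
      omega

theorem tri {n : ℕ} {π σ : NCM n} (h : CmatSeq (plus π) σ ≠ 0) (j : Fin n) :
    plus σ j ≤ plus π j := by
  by_contra hc
  push Not at hc
  obtain ⟨x, hx, hxe⟩ := plus_mem σ j
  have k := key h (2 * n - x) x (2 * n) (by omega) le_rfl (fun y _ _ _ => (σ.f y).isLt)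
  rw [← plus_count, ← plus_count] at k
  have h1 : Finset.Ici j ⊆ Finset.univ.filter
      fun m : Fin n => (x : ℕ) + 1 ≤ plus σ m ∧ plus σ m < 2 * n + 1 := by
    intro i hi
    simp only [Finset.mem_filter, Finset.mem_univ, true_and]
    have := (plus_strictMono σ).monotone (Finset.mem_Ici.mp hi)
    obtain ⟨y, _, hy⟩ := plus_mem σ i
    omega
  have h2 : (Finset.univ.filter
      fun m : Fin n => (x : ℕ) + 1 ≤ plus π m ∧ plus π m < 2 * n + 1) ⊆ Finset.Ioi j := by
    intro i hi
    simp only [Finset.mem_filter, Finset.mem_univ, true_and] at hi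
    rw [Finset.mem_Ioi]
    by_contra hij
    have := (plus_strictMono π).monotone (not_lt.mp hij)
    omega
  have c1 := Finset.card_le_card h1
  have c2 := Finset.card_le_card h2
  rw [Fin.card_Ici] at c1
  rw [Fin.card_Ioi] at c2
  omega

theorem not_lt_aux {n : ℕ} {π σ : NCM n} (ho : ∀ x, x < π.f x ↔ x < σ.f x)
    (m : Fin (2 * n)) (hm : m < π.f m) (hlt : π.f m < σ.f m) : False := by
  have hin := inside σ hm hlt
  have hcl : ¬ π.f m < σ.f (π.f m) := by
    rw [← ho, π.invol]
    exact not_lt.mpr hm.le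
  have hlo : σ.f (π.f m) < π.f m := lt_of_le_of_ne (not_lt.mp hcl) (σ.nofix _)
  obtain ⟨l, hl⟩ : ∃ l, l = σ.f (π.f m) := ⟨_, rfl⟩
  have hl2 : σ.f l = π.f m := by rw [hl, σ.invol]
  rw [← hl] at hin hlo
  have a := arc_count σ l (by rw [hl2]; exact hlo)
  have o := op_one_of σ l (by rw [hl2]; exact hlo)
  rw [hl2] at a
  have hlo' : (l : ℕ) < π.f m := hlo
  have s := op_split σ (a := l) (b := l + 1) (c := π.f m) (by omega) (by omega)
  have e : op π l (π.f m) = op σ l (π.f m) := by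
    unfold op
    simp only [ho]
  have hin1 : (m : ℕ) < l := hin.1
  have le := op_le_cl π l (π.f m) (fun x _ h1 h2 =>
    (inside π (m := m) (x := x) (by rw [Fin.lt_def]; omega) h2).2)
  have t := op_add_cl π (j := l) (k := π.f m) (π.f m).isLt.le
  omega

theorem plus_injective {n : ℕ} : Function.Injective (plus (n := n)) := by
  intro π σ h
  have aux : ∀ {π σ : NCM n}, plus π = plus σ → ∀ x, x < π.f x → x < σ.f x := by
    intro π σ h x hx
    obtain ⟨i, hi⟩ := plus_surj π x hx
    rw [h] at hi
    obtain ⟨y, hy, hy2⟩ := plus_mem σ i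
    have : x = y := Fin.ext (by omega)
    rwa [this]
  have ho : ∀ x, x < π.f x ↔ x < σ.f x := fun x => ⟨aux h x, aux h.symm x⟩
  have he : ∀ x, x < π.f x → π.f x = σ.f x := by
    intro x hx
    rcases lt_trichotomy (π.f x) (σ.f x) with h1 | h1 | h1
    · exact (not_lt_aux ho x hx h1).elim
    · exact h1
    · exact (not_lt_aux (fun x => (ho x).symm) x ((ho x).1 hx) h1).elim
  apply NCM.ext'
  funext x
  by_cases hx : x < π.f x
  · exact he x hx
  · have hx2 : π.f x < x := lt_of_le_of_ne (not_lt.mp hx) (π.nofix _)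
    have := he (π.f x) (by rw [π.invol]; exact hx2)
    rw [π.invol] at this
    apply f_inj σ
    rw [← this, σ.invol]

theorem unit {n : ℕ} : IsUnit (Matrix.of fun π σ : NCM n => (CmatSeq (plus π) σ : ℤ)) := by
  rw [Matrix.isUnit_iff_isUnit_det]
  letI : LinearOrder (NCM n) :=
    LinearOrder.lift' (fun π : NCM n => toLex (plus π)) (fun _ _ h => plus_injective h)
  have key : (Matrix.of fun π σ : NCM n => (CmatSeq (plus π) σ : ℤ)).det = 1 := by
    have ht : (Matrix.of fun π σ : NCM n => (CmatSeq (plus π) σ : ℤ)).BlockTriangular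
        OrderDual.toDual := by
      intro π σ hlt
      by_contra hne
      have hle : plus σ ≤ plus π := fun j => tri hne j
      have h2 : toLex (plus σ) ≤ toLex (plus π) := Pi.toLex_monotone hle
      have h3 : toLex (plus π) < toLex (plus σ) := hlt
      exact absurd (h2.trans_lt h3) (lt_irrefl _)
    rw [Matrix.det_of_lowerTriangular _ ht]
    exact Finset.prod_eq_one fun π _ => diag π
  convert isUnit_one using 1
  convert key

end CmatAux

/-- The matrix `(C_{π,σ})` has unit diagonal, is triangular with respect to the
entrywise partial order on `π⁺`, and is invertible over `ℤ` (so its inverse has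
integer entries). -/
theorem Cmat_triangular (n : ℕ) (hn : 1 ≤ n) :
    (∀ π : NCM n, CmatSeq (plus π) π = 1) ∧
    (∀ π σ : NCM n, CmatSeq (plus π) σ ≠ 0 → ∀ j : Fin n, plus σ j ≤ plus π j) ∧
    IsUnit (Matrix.of fun π σ : NCM n => (CmatSeq (plus π) σ : ℤ)) := by
  exact ⟨CmatAux.diag, fun _ _ h j => CmatAux.tri h j, CmatAux.unit⟩
end

section
/- Let n ≥ 1, let a = (a_1,…,a_n) satisfy a_1 = 1 and a_j ∈ {2j−2, 2j−1} for all 2 ≤ j ≤ n (so that a ∈ B_n ⊆ NC_n^+), and let σ ∈ NC_n. Then C_{a,σ} = 1 if σ ∈ L(a), and C_{a,σ} = 0 otherwise, where L(a) = {π ∈ NC_n : for each 1 ≤ j ≤ n, π(2j−1) > 2j−1 if and only if a_j = 2j−1}. -/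
open scoped BigOperators

open MvPolynomial

attribute [local instance 10] Classical.propDecidable

theorem ncm_parity {n : ℕ} (σ : NCM n) (j k : Fin (2 * n)) (hjk : j < k) (h : σ.f j = k) :
    ((k : ℕ) - (j : ℕ)) % 2 = 1 := by
  have hk : σ.f k = j := by rw [← h, σ.invol]
  have hclosed : ∀ x ∈ Finset.Ioo j k, σ.f x ∈ Finset.Ioo j k := by
    intro x hx
    rw [Finset.mem_Ioo] at hx ⊢
    have hx1 : σ.f x ≠ j := by
      intro e
      have : σ.f (σ.f x) = k := by rw [e, h]
      rw [σ.invol] at this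
      exact absurd this (ne_of_lt hx.2)
    have hx2 : σ.f x ≠ k := by
      intro e
      have : σ.f (σ.f x) = j := by rw [e, hk]
      rw [σ.invol] at this
      exact absurd this (ne_of_gt hx.1)
    constructor
    · by_contra hc
      have hlt : σ.f x < j := lt_of_le_of_ne (not_lt.mp hc) hx1
      exact σ.noncross (σ.f x) j x k hlt hx.1 hx.2 (σ.invol x) h
    · by_contra hc
      have hlt : k < σ.f x := lt_of_le_of_ne (not_lt.mp hc) (Ne.symm hx2)
      exact σ.noncross j x k (σ.f x) hx.1 hx.2 hlt h rfl
  have hsum : ∑ x ∈ Finset.Ioo j k, (1 : ZMod 2) = 0 := by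
    refine Finset.sum_involution (fun x _ => σ.f x) ?_ ?_ ?_ ?_
    · intro x _; decide
    · intro x _ _; exact σ.nofix x
    · intro x hx; exact hclosed x hx
    · intro x _; exact σ.invol x
  rw [Finset.sum_const, nsmul_eq_mul, mul_one, Fin.card_Ioo,
    ZMod.natCast_eq_zero_iff] at hsum
  have : (j : ℕ) < k := hjk
  omega

theorem pjk_even {n : ℕ} (a : Fin n → ℕ)
    (ha : ∀ i : Fin n, a i = 2 * (i : ℕ) ∨ a i = 2 * (i : ℕ) + 1) (s t : Fin n) (hst : s ≤ t) :
    chi (pjkSeq a (2 * (s : ℕ) + 1) (2 * (t : ℕ) + 1 + 1)) =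
      if a s = 2 * (s : ℕ) + 1 then 1 else 0 := by
  have hst' : (s : ℕ) ≤ t := hst
  unfold pjkSeq
  split_ifs with h
  · have : (Finset.univ.filter fun m : Fin n =>
        2 * (s : ℕ) + 1 ≤ a m ∧ a m < 2 * (t : ℕ) + 1 + 1) = Finset.Icc s t := by
      ext m
      have hm := ha m
      simp only [Finset.mem_filter, Finset.mem_univ, true_and, Finset.mem_Icc, Fin.le_def]
      by_cases e : m = s
      · subst e; omega
      · have : (m : ℕ) ≠ s := fun h => e (Fin.ext h)
        omega
    rw [this, Fin.card_Icc]
    have : (((t : ℕ) + 1 - (s : ℕ) : ℕ) : ℤ)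
      - (((2 * (t : ℕ) + 1 + 1 - (2 * (s : ℕ) + 1) - 1) / 2 : ℕ) : ℤ) = 1 := by omega
    rw [this]; decide
  · have : (Finset.univ.filter fun m : Fin n =>
        2 * (s : ℕ) + 1 ≤ a m ∧ a m < 2 * (t : ℕ) + 1 + 1) = Finset.Ioc s t := by
      ext m
      have hm := ha m
      simp only [Finset.mem_filter, Finset.mem_univ, true_and, Finset.mem_Ioc, Fin.le_def,
        Fin.lt_def]
      by_cases e : m = s
      · subst e; omega
      · have : (m : ℕ) ≠ s := fun h => e (Fin.ext h)
        omega
    rw [this, Fin.card_Ioc]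
    have : (((t : ℕ) - (s : ℕ) : ℕ) : ℤ)
      - (((2 * (t : ℕ) + 1 + 1 - (2 * (s : ℕ) + 1) - 1) / 2 : ℕ) : ℤ) = 0 := by omega
    rw [this]; decide

theorem pjk_odd {n : ℕ} (a : Fin n → ℕ)
    (ha : ∀ i : Fin n, a i = 2 * (i : ℕ) ∨ a i = 2 * (i : ℕ) + 1) (s t : Fin n) (hst : s ≤ t) :
    chi (pjkSeq a (2 * (s : ℕ)) (2 * (t : ℕ) + 1)) =
      if a t = 2 * (t : ℕ) + 1 then 0 else 1 := by
  have hst' : (s : ℕ) ≤ t := hst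
  unfold pjkSeq
  split_ifs with h
  · have : (Finset.univ.filter fun m : Fin n =>
        2 * (s : ℕ) ≤ a m ∧ a m < 2 * (t : ℕ) + 1) = Finset.Ico s t := by
      ext m
      have hm := ha m
      simp only [Finset.mem_filter, Finset.mem_univ, true_and, Finset.mem_Ico, Fin.le_def,
        Fin.lt_def]
      by_cases e : m = t
      · subst e; omega
      · have : (m : ℕ) ≠ t := fun h => e (Fin.ext h)
        omega
    rw [this, Fin.card_Ico]
    have : (((t : ℕ) - (s : ℕ) : ℕ) : ℤ)
      - (((2 * (t : ℕ) + 1 - (2 * (s : ℕ)) - 1) / 2 : ℕ) : ℤ) = 0 := by omega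
    rw [this]; decide
  · have : (Finset.univ.filter fun m : Fin n =>
        2 * (s : ℕ) ≤ a m ∧ a m < 2 * (t : ℕ) + 1) = Finset.Icc s t := by
      ext m
      have hm := ha m
      simp only [Finset.mem_filter, Finset.mem_univ, true_and, Finset.mem_Icc, Fin.le_def]
      by_cases e : m = t
      · subst e; omega
      · have : (m : ℕ) ≠ t := fun h => e (Fin.ext h)
        omega
    rw [this, Fin.card_Icc]
    have : (((t : ℕ) + 1 - (s : ℕ) : ℕ) : ℤ)
      - (((2 * (t : ℕ) + 1 - (2 * (s : ℕ)) - 1) / 2 : ℕ) : ℤ) = 1 := by omega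
    rw [this]; decide

/-- Factor of a matched pair whose left end is the even point `2 i`. -/
theorem factor_open {n : ℕ} (a : Fin n → ℕ)
    (ha : ∀ i : Fin n, a i = 2 * (i : ℕ) ∨ a i = 2 * (i : ℕ) + 1) (σ : NCM n)
    (j k : Fin (2 * n)) (hjk : j < k) (h : σ.f j = k) (i : Fin n) (hi : (j : ℕ) = 2 * (i : ℕ)) :
    chi (pjkSeq a ((j : ℕ) + 1) ((k : ℕ) + 1)) = if a i = 2 * (i : ℕ) + 1 then 1 else 0 := by
  have hp := ncm_parity σ j k hjk h
  have hlt : (j : ℕ) < k := hjk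
  have hk := k.isLt
  have e := pjk_even a ha i ⟨(k : ℕ) / 2, by omega⟩ (Fin.le_def.mpr (by simp only []; omega))
  have ek : 2 * ((k : ℕ) / 2) + 1 = k := by omega
  simp only [ek] at e
  rw [hi, e]

/-- Factor of a matched pair whose right end is the even point `2 i`. -/
theorem factor_close {n : ℕ} (a : Fin n → ℕ)
    (ha : ∀ i : Fin n, a i = 2 * (i : ℕ) ∨ a i = 2 * (i : ℕ) + 1) (σ : NCM n)
    (j k : Fin (2 * n)) (hjk : j < k) (h : σ.f j = k) (i : Fin n) (hi : (k : ℕ) = 2 * (i : ℕ)) :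
    chi (pjkSeq a ((j : ℕ) + 1) ((k : ℕ) + 1)) = if a i = 2 * (i : ℕ) + 1 then 0 else 1 := by
  have hp := ncm_parity σ j k hjk h
  have hlt : (j : ℕ) < k := hjk
  have hk := k.isLt
  have e := pjk_odd a ha ⟨((j : ℕ) + 1) / 2, by omega⟩ i (Fin.le_def.mpr (by simp only []; omega))
  have ej : 2 * (((j : ℕ) + 1) / 2) = (j : ℕ) + 1 := by omega
  simp only [ej] at e
  rw [hi, e]

/-- Theorem 2.20 (coefficient form): for `a ∈ B_n` (so `a_1 = 1`,
`a_j ∈ {2j-2, 2j-1}`), `C_{a,σ} = 1` if `σ ∈ L(a)` and `0` otherwise. -/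
theorem Cmat_product_sequences (n : ℕ) (hn : 1 ≤ n) (a : Fin n → ℕ)
    (ha1 : a ⟨0, by omega⟩ = 1)
    (ha2 : ∀ i : Fin n, 1 ≤ (i : ℕ) → a i = 2 * (i : ℕ) ∨ a i = 2 * (i : ℕ) + 1)
    (σ : NCM n) :
    CmatSeq a σ =
      if ∀ i : Fin n, ∀ h : 2 * (i : ℕ) < 2 * n,
          (2 * (i : ℕ) < (σ.f ⟨2 * (i : ℕ), h⟩ : ℕ) ↔ a i = 2 * (i : ℕ) + 1)
      then 1 else 0 := by
  have ha : ∀ i : Fin n, a i = 2 * (i : ℕ) ∨ a i = 2 * (i : ℕ) + 1 := by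
    intro i
    by_cases h0 : 1 ≤ (i : ℕ)
    · exact ha2 i h0
    · have : i = ⟨0, by omega⟩ := Fin.ext (by simp only []; omega)
      rw [this]; right; simpa using ha1
  unfold CmatSeq
  split_ifs with H
  · refine Finset.prod_eq_one fun j _ => Finset.prod_eq_one fun k _ => ?_
    split_ifs with h
    · obtain ⟨hjk, hf⟩ := h
      have hp := ncm_parity σ j k hjk hf
      have hlt : (j : ℕ) < k := hjk
      have hj := j.isLt
      have hk := k.isLt
      rcases Nat.even_or_odd' (j : ℕ) with ⟨s, hs | hs⟩
      · have Hs := H ⟨s, by omega⟩ (by simp only []; omega)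
        have e : (⟨2 * s, by omega⟩ : Fin (2 * n)) = j := Fin.ext hs.symm
        simp only [e, hf] at Hs
        rw [factor_open a ha σ j k hjk hf ⟨s, by omega⟩ hs, if_pos (Hs.mp (by omega))]
      · have Hs := H ⟨(k : ℕ) / 2, by omega⟩ (by simp only []; omega)
        have ek : 2 * ((k : ℕ) / 2) = k := by omega
        have hfk : σ.f k = j := by rw [← hf, σ.invol]
        simp only [ek, Fin.eta, hfk] at Hs
        rw [factor_close a ha σ j k hjk hf ⟨(k : ℕ) / 2, by omega⟩ ek.symm, if_neg]
        intro hc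
        have := Hs.mpr (by simpa only [ek] using hc)
        omega
    · rfl
  · push Not at H
    obtain ⟨i, h, H⟩ := H
    rcases H with ⟨h1, h2⟩ | ⟨h1, h2⟩
    · refine Finset.prod_eq_zero (Finset.mem_univ (⟨2 * (i : ℕ), h⟩ : Fin (2 * n))) ?_
      refine Finset.prod_eq_zero (Finset.mem_univ (σ.f ⟨2 * (i : ℕ), h⟩)) ?_
      rw [if_pos ⟨Fin.lt_def.mpr h1, rfl⟩,
        factor_open a ha σ _ _ (Fin.lt_def.mpr h1) rfl i rfl, if_neg h2]
    · have hlt : σ.f ⟨2 * (i : ℕ), h⟩ < ⟨2 * (i : ℕ), h⟩ :=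
        lt_of_le_of_ne (Fin.le_def.mpr h1) (σ.nofix _)
      refine Finset.prod_eq_zero (Finset.mem_univ (σ.f ⟨2 * (i : ℕ), h⟩)) ?_
      refine Finset.prod_eq_zero (Finset.mem_univ (⟨2 * (i : ℕ), h⟩ : Fin (2 * n))) ?_
      rw [if_pos ⟨hlt, σ.invol _⟩,
        factor_close a ha σ _ _ hlt (σ.invol _) i rfl, if_pos h2]
end
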